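/- For every t ≥ 0, ∫₀^{t} (1 − cos s)/s ds ≤ γ + log 15 + 91/30 + 2·max(0, log t), where γ is the Euler–Mascheroni constant. -/

import Mathlib

open Real

lemma abs_one_sub_cos_div_self_le (s : ℝ) : |(1 - Real.cos s) / s| ≤ |s| := by
  rcases eq_or_ne s 0 with rfl | hs
  · simp
  · rw [abs_div, div_le_iff₀ (abs_pos.mpr hs), abs_mul_abs_self,
      abs_of_nonneg (sub_nonneg.mpr (Real.cos_le_one s))]
    nlinarith [Real.one_sub_sq_div_two_le_cos (x := s), sq_nonneg s]

lemma intervalIntegrable_one_sub_cos_div_self (a b : ℝ) :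
    IntervalIntegrable (fun s : ℝ => (1 - Real.cos s) / s) MeasureTheory.volume a b := by
  refine (continuous_abs.intervalIntegrable a b).mono_fun' ?_ ?_
  · exact Measurable.aestronglyMeasurable (by fun_prop)
  · exact Filter.Eventually.of_forall abs_one_sub_cos_div_self_le

lemma integral_one_sub_cos_div_self_le_one {t : ℝ} (ht : 0 ≤ t) (ht1 : t ≤ 1) :
    ∫ s in (0 : ℝ)..t, (1 - Real.cos s) / s ≤ 1 := by
  calc ∫ s in (0 : ℝ)..t, (1 - Real.cos s) / s
      ≤ ∫ _ in (0 : ℝ)..t, (1 : ℝ) := by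
        refine intervalIntegral.integral_mono_on ht
          (intervalIntegrable_one_sub_cos_div_self 0 t) (by simp) fun s hs => ?_
        refine (le_abs_self _).trans ((abs_one_sub_cos_div_self_le s).trans ?_)
        rw [abs_of_nonneg hs.1]
        exact hs.2.trans ht1
    _ ≤ 1 := by simpa using ht1

lemma integral_one_sub_cos_div_self_le_two_mul_log {t : ℝ} (ht : 1 ≤ t) :
    ∫ s in (1 : ℝ)..t, (1 - Real.cos s) / s ≤ 2 * Real.log t := by
  have h0 : (0 : ℝ) ∉ Set.uIcc 1 t := by
    rw [Set.uIcc_of_le ht]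
    exact fun h => absurd h.1 (by norm_num)
  calc ∫ s in (1 : ℝ)..t, (1 - Real.cos s) / s
      ≤ ∫ s in (1 : ℝ)..t, 2 * (1 / s) := by
        refine intervalIntegral.integral_mono_on ht
          (intervalIntegrable_one_sub_cos_div_self 1 t) ?_ fun s hs => ?_
        · exact (intervalIntegral.intervalIntegrable_one_div
            (fun x hx h => h0 (h ▸ hx)) continuousOn_id).const_mul 2
        · have hs0 : 0 < s := one_pos.trans_le hs.1
          rw [mul_one_div]
          gcongr
          linarith [Real.neg_one_le_cos s]
    _ = 2 * Real.log t := by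
        rw [intervalIntegral.integral_const_mul, integral_one_div h0, div_one]

/-- For every `t ≥ 0`,
`∫₀^{t} (1 − cos s)/s ds ≤ γ + log 15 + 91/30 + 2·max(0, log t)`,
where `γ` is the Euler–Mascheroni constant. -/
theorem sine_integral_log_bound (t : ℝ) (ht : 0 ≤ t) :
    ∫ s in (0 : ℝ)..t, (1 - Real.cos s) / s
      ≤ Real.eulerMascheroniConstant + Real.log 15 + 91 / 30
        + 2 * max 0 (Real.log t) := by
  have hγ := Real.one_half_lt_eulerMascheroniConstant
  have hlog : 0 ≤ Real.log 15 := Real.log_nonneg (by norm_num)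
  rcases le_total t 1 with h | h
  · linarith [integral_one_sub_cos_div_self_le_one ht h, le_max_left 0 (Real.log t)]
  · rw [← intervalIntegral.integral_add_adjacent_intervals
      (intervalIntegrable_one_sub_cos_div_self 0 1) (intervalIntegrable_one_sub_cos_div_self 1 t)]
    linarith [integral_one_sub_cos_div_self_le_one zero_le_one le_rfl,
      integral_one_sub_cos_div_self_le_two_mul_log h, le_max_right 0 (Real.log t)]
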